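/- arXiv:2602.20429 — 7 statements merged into one kernel-verified Lean document; each statement's English description precedes it below -/
import Mathlib

section
/- Let n ≥ 1 and x ∈ [0,1]ⁿ, and let x̄ := (∏_{j=1}^n x_j)^{1/n} be the geometric mean of the coordinates. Then for every integer t with 1 ≤ t ≤ n, B_t(x₁, …, xₙ) ≤ B_t(x̄, …, x̄). -/
/-- `bernCDF n t x` is the probability that `n` independent Bernoulli trials with success
probabilities `x 0, …, x (n-1)` produce at most `t - 1` (i.e. fewer than `t`) successes:
`B_t(x) = Σ_{A ⊆ [n], |A| ≤ t−1} ∏_{j∈A} x_j · ∏_{j∉A} (1−x_j)`. -/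
def bernCDF (n t : ℕ) (x : Fin n → ℝ) : ℝ :=
  ∑ A ∈ Finset.univ.filter (fun A : Finset (Fin n) => A.card ≤ t - 1),
    (∏ j ∈ A, x j) * ∏ j ∈ Aᶜ, (1 - x j)

/-- The CDF with the probability of each success set written as a single product over all trials. -/
lemma bernCDF_eq_sum_prod_ite (n t : ℕ) (x : Fin n → ℝ) :
    bernCDF n t x = ∑ A : Finset (Fin n),
      if A.card ≤ t - 1 then ∏ k, (if k ∈ A then x k else 1 - x k) else 0 := by
  rw [bernCDF, Finset.sum_filter]
  refine Finset.sum_congr rfl fun A _ => ?_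
  rw [← Finset.prod_mul_prod_compl A (fun k => if k ∈ A then x k else 1 - x k)]
  congr 2
  · exact Finset.prod_congr rfl fun k hk => by simp [hk]
  · exact Finset.prod_congr rfl fun k hk => by simp [Finset.mem_compl.mp hk]

/-- Conditioning on all trials except `i` and `j`. -/
lemma bernCDF_eq_sum_pair {n : ℕ} (t : ℕ) (x : Fin n → ℝ) {i j : Fin n} (hij : i ≠ j) :
    bernCDF n t x = ∑ C ∈ ((Finset.univ.erase i).erase j).powerset,
      (∏ k ∈ (Finset.univ.erase i).erase j, if k ∈ C then x k else 1 - x k) *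
        ((1 - x i) * (1 - x j) * (if C.card ≤ t - 1 then 1 else 0) +
          ((1 - x i) * x j + x i * (1 - x j)) * (if C.card + 1 ≤ t - 1 then 1 else 0) +
          x i * x j * (if C.card + 2 ≤ t - 1 then 1 else 0)) := by
  rw [bernCDF_eq_sum_prod_ite, ← Finset.powerset_univ]
  set R := (Finset.univ.erase i).erase j with hR
  have hi : i ∉ R := by simp [hR]
  have hj : j ∉ R := by simp [hR]
  have hiR : i ∉ insert j R := by simp [hij, hi]
  have huniv : (Finset.univ : Finset (Fin n)) = insert i (insert j R) := by
    ext k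
    simp only [hR, Finset.mem_univ, Finset.mem_insert, Finset.mem_erase]
    tauto
  rw [huniv, Finset.sum_powerset_insert hiR, Finset.sum_powerset_insert hj,
    Finset.sum_powerset_insert hj, ← Finset.sum_add_distrib, ← Finset.sum_add_distrib,
    ← Finset.sum_add_distrib]
  refine Finset.sum_congr rfl fun C hC => ?_
  have hCR := Finset.mem_powerset.mp hC
  have hiC : i ∉ C := fun h => hi (hCR h)
  have hjC : j ∉ C := fun h => hj (hCR h)
  have hprod : ∀ A : Finset (Fin n), (∀ k ∈ R, (k ∈ A ↔ k ∈ C)) →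
      (∏ k ∈ R, if k ∈ A then x k else 1 - x k) = ∏ k ∈ R, if k ∈ C then x k else 1 - x k :=
    fun A hA => Finset.prod_congr rfl fun k hk => by simp only [hA k hk]
  have hne : ∀ k ∈ R, k ≠ i ∧ k ≠ j :=
    fun k hk => ⟨fun h => hi (h ▸ hk), fun h => hj (h ▸ hk)⟩
  have hiC' : i ∉ insert j C := by simp [hij, hiC]
  simp only [Finset.prod_insert hiR, Finset.prod_insert hj]
  rw [hprod (insert j C) fun k hk => by simp [hne k hk],
    hprod (insert i C) fun k hk => by simp [hne k hk],
    hprod (insert i (insert j C)) fun k hk => by simp [hne k hk],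
    Finset.card_insert_of_notMem hiC', Finset.card_insert_of_notMem hjC,
    Finset.card_insert_of_notMem hiC]
  simp only [Finset.mem_insert, hiC, hjC, hij, hij.symm, or_false, or_true, if_true,
    if_false, add_assoc, Nat.reduceAdd]
  split_ifs <;> ring

/-- Lowering the sum of two parameters at a fixed product increases the CDF. -/
lemma bernCDF_le_of_mul_eq_of_add_le {n : ℕ} (t : ℕ) {x y : Fin n → ℝ}
    (hx : ∀ k, x k ∈ Set.Icc (0 : ℝ) 1) {i j : Fin n} (hij : i ≠ j)
    (hxy : ∀ k, k ≠ i → k ≠ j → y k = x k) (hmul : y i * y j = x i * x j)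
    (hadd : y i + y j ≤ x i + x j) : bernCDF n t x ≤ bernCDF n t y := by
  rw [bernCDF_eq_sum_pair t x hij, bernCDF_eq_sum_pair t y hij]
  refine Finset.sum_le_sum fun C _ => ?_
  have hprod : (∏ k ∈ (Finset.univ.erase i).erase j, if k ∈ C then y k else 1 - y k) =
      ∏ k ∈ (Finset.univ.erase i).erase j, if k ∈ C then x k else 1 - x k :=
    Finset.prod_congr rfl fun k hk => by
      simp only [Finset.mem_erase] at hk
      rw [hxy k hk.2.1 hk.1]
  rw [hprod]
  refine mul_le_mul_of_nonneg_left ?_ (Finset.prod_nonneg fun k _ => ?_)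
  · split_ifs <;> first | omega | nlinarith
  · split_ifs
    · exact (hx k).1
    · linarith [(hx k).2]

lemma bernCDF_le_one (n t : ℕ) {x : Fin n → ℝ} (hx : ∀ k, x k ∈ Set.Icc (0 : ℝ) 1) :
    bernCDF n t x ≤ 1 := by
  have htotal : ∑ A : Finset (Fin n), (∏ j ∈ A, x j) * ∏ j ∈ Aᶜ, (1 - x j) = 1 := by
    have h := Finset.prod_add x (fun j => 1 - x j) Finset.univ
    simpa [Finset.compl_eq_univ_sdiff] using h.symm
  rw [← htotal, bernCDF]
  refine Finset.sum_le_sum_of_subset_of_nonneg (Finset.subset_univ _) fun A _ _ => ?_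
  exact mul_nonneg (Finset.prod_nonneg fun k _ => (hx k).1)
    (Finset.prod_nonneg fun k _ => by linarith [(hx k).2])

lemma bernCDF_zero (n t : ℕ) : bernCDF n t (fun _ => 0) = 1 := by
  rw [bernCDF, Finset.sum_eq_single_of_mem ∅ (by simp)]
  · simp
  · intro A _ hA
    simp [Finset.card_ne_zero.mpr (Finset.nonempty_iff_ne_empty.mpr hA)]

/-- If the product of the parameters is `g ^ n`, they can be moved to `g` one at a time, each step
preserving the product and increasing the CDF. -/
lemma bernCDF_le_of_prod_eq_pow {n : ℕ} (t : ℕ) {g : ℝ} (hg : 0 < g) (x : Fin n → ℝ)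
    (hx : ∀ k, x k ∈ Set.Icc (0 : ℝ) 1) (hprod : ∏ k, x k = g ^ n) :
    bernCDF n t x ≤ bernCDF n t (fun _ => g) := by
  induction hm : (Finset.univ.filter fun k => x k ≠ g).card using Nat.strong_induction_on
    generalizing x with
  | _ m ih =>
  have hpos : ∀ k, 0 < x k := fun k => (hx k).1.lt_of_ne' fun h => by
    have h0 := Finset.prod_eq_zero (Finset.mem_univ k) h
    rw [hprod] at h0
    exact (pow_pos hg n).ne' h0
  have hconst : ∏ _k : Fin n, g = g ^ n := by simp
  by_cases hall : ∀ k, x k = g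
  · rw [funext hall]
  obtain ⟨l, hl⟩ := not_forall.mp hall
  obtain ⟨i, hi⟩ : ∃ i, x i < g := by
    by_contra! h
    have := Finset.prod_lt_prod (fun k _ => hg) (fun k _ => h k)
      ⟨l, Finset.mem_univ l, (h l).lt_of_ne' hl⟩
    linarith
  obtain ⟨j, hj⟩ : ∃ j, g < x j := by
    by_contra! h
    have := Finset.prod_lt_prod (fun k _ => hpos k) (fun k _ => h k)
      ⟨l, Finset.mem_univ l, (h l).lt_of_ne hl⟩
    linarith
  have hij : i ≠ j := by rintro rfl; linarith
  set y := Function.update (Function.update x i g) j (x i * x j / g) with hy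
  have hyi : y i = g := by simp [hy, hij]
  have hyj : y j = x i * x j / g := by simp [hy]
  have hyk : ∀ k, k ≠ i → k ≠ j → y k = x k := fun k h₁ h₂ => by simp [hy, h₁, h₂]
  have hmul : y i * y j = x i * x j := by rw [hyi, hyj]; field_simp
  have hadd : y i + y j ≤ x i + x j := by
    rw [hyi] at hmul ⊢
    nlinarith
  have hyIcc : ∀ k, y k ∈ Set.Icc (0 : ℝ) 1 := by
    intro k
    rcases eq_or_ne k j with rfl | hkj
    · rw [hyj, Set.mem_Icc, div_le_one hg]
      refine ⟨by have := hpos i; have := hpos k; positivity, ?_⟩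
      nlinarith [hpos i, (hx k).2]
    rcases eq_or_ne k i with rfl | hki
    · rw [hyi]
      exact ⟨hg.le, hj.le.trans (hx j).2⟩
    · rw [hyk k hki hkj]
      exact hx k
  have hsplit : ∀ z : Fin n → ℝ,
      ∏ k, z k = z i * z j * ∏ k ∈ (Finset.univ.erase i).erase j, z k := fun z => by
    rw [mul_assoc, Finset.mul_prod_erase _ z (by simp [hij.symm]),
      Finset.mul_prod_erase _ z (Finset.mem_univ i)]
  have hyprod : ∏ k, y k = g ^ n := by
    rw [← hprod, hsplit y, hsplit x, hmul]
    congr 1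
    refine Finset.prod_congr rfl fun k hk => ?_
    simp only [Finset.mem_erase] at hk
    exact hyk k hk.2.1 hk.1
  refine (bernCDF_le_of_mul_eq_of_add_le t hx hij hyk hmul hadd).trans
    (ih _ ?_ y hyIcc hyprod rfl)
  rw [← hm]
  refine Finset.card_lt_card (Finset.ssubset_iff_of_subset ?_ |>.mpr ⟨i, by simp [hi.ne], by
    simp [hyi]⟩)
  intro k hk
  simp only [Finset.mem_filter, Finset.mem_univ, true_and] at hk ⊢
  rcases eq_or_ne k j with rfl | hkj
  · exact hj.ne'
  rcases eq_or_ne k i with rfl | hki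
  · exact hi.ne
  · rwa [hyk k hki hkj] at hk

/-- Replacing all Bernoulli parameters by their common geometric mean pointwise increases the
CDF of every order statistic: for every `1 ≤ t ≤ n`, `B_t(x₁, …, xₙ) ≤ B_t(x̄, …, x̄)` where
`x̄` is the geometric mean of the `xⱼ`. -/
theorem bernCDF_le_bernCDF_geometricMean
    (n : ℕ) (hn : 1 ≤ n) (x : Fin n → ℝ) (hx : ∀ j, x j ∈ Set.Icc (0 : ℝ) 1)
    (xbar : ℝ) (hxbar : xbar = (∏ j, x j) ^ (1 / (n : ℝ)))
    (t : ℕ) (ht1 : 1 ≤ t) (htn : t ≤ n) :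
    bernCDF n t x ≤ bernCDF n t (fun _ => xbar) := by
  have hnonneg : 0 ≤ ∏ j, x j := Finset.prod_nonneg fun j _ => (hx j).1
  have hpow : ∏ j, x j = xbar ^ n := by
    rw [hxbar, one_div, Real.rpow_inv_natCast_pow hnonneg (by omega)]
  have hbar : 0 ≤ xbar := hxbar ▸ Real.rpow_nonneg hnonneg _
  rcases hbar.eq_or_lt with h0 | hpos
  · rw [← h0, bernCDF_zero]
    exact bernCDF_le_one n t hx
  · exact bernCDF_le_of_prod_eq_pow t hpos x hx hpow
end

section
/- Let n ≥ 1, let a⁰ : {1,…,n} → [0,1] be an initial vector, and let (i_t, j_t)_{t ∈ ℕ} be a sequence of pairs of distinct indices in {1,…,n}. Define recursively a^{t+1}_{i_t} = a^{t+1}_{j_t} = √(a^t_{i_t} · a^t_{j_t}) and a^{t+1}_m = a^t_m for m ∉ {i_t, j_t}. If every unordered pair of distinct indices {i,j} occurs infinitely often in the sequence, then for every index i, the sequence a^t_i converges as t → ∞ to the geometric mean (∏_{m=1}^n a⁰_m)^{1/n}. -/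
open Filter Topology

/-- `y` arises from `x` by replacing the values at `i` and `j` with their arithmetic mean. -/
def IsPairAverage {ι : Type*} (i j : ι) (x y : ι → ℝ) : Prop :=
  y i = (x i + x j) / 2 ∧ y j = (x i + x j) / 2 ∧ ∀ m, m ≠ i → m ≠ j → y m = x m

namespace IsPairAverage

variable {ι : Type*} {i j : ι} {x y : ι → ℝ}

theorem sum_comp_sub [Fintype ι] (h : IsPairAverage i j x y) (hij : i ≠ j) (φ : ℝ → ℝ) :
    ∑ m, φ (y m) - ∑ m, φ (x m) = 2 * φ ((x i + x j) / 2) - φ (x i) - φ (x j) := by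
  rw [← Finset.sum_sub_distrib, Fintype.sum_eq_add i j hij, h.1, h.2.1]
  · ring
  · rintro m ⟨hi, hj⟩
    rw [h.2.2 m hi hj, sub_self]

theorem sum_eq [Fintype ι] (h : IsPairAverage i j x y) (hij : i ≠ j) :
    ∑ m, y m = ∑ m, x m := by
  have := h.sum_comp_sub hij id
  simp only [id] at this
  linarith

theorem sum_sq_eq [Fintype ι] (h : IsPairAverage i j x y) (hij : i ≠ j) :
    ∑ m, y m ^ 2 = ∑ m, x m ^ 2 - (x i - x j) ^ 2 / 2 := by
  have := h.sum_comp_sub hij (· ^ 2)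
  linarith

/-- Averaging a pair lying on one side of a gap preserves the gap. -/
theorem separated (h : IsPairAverage i j x y) {U : Set ι} {c d : ℝ} (hU : i ∈ U ↔ j ∈ U)
    (hx : ∀ m, (m ∈ U → d < x m) ∧ (m ∉ U → x m ≤ c)) (m : ι) :
    (m ∈ U → d < y m) ∧ (m ∉ U → y m ≤ c) := by
  have key : ∀ k, k = i ∨ k = j → y k = (x i + x j) / 2 := by
    rintro k (rfl | rfl)
    exacts [h.1, h.2.1]
  by_cases hm : m = i ∨ m = j
  · have hmi : m ∈ U ↔ i ∈ U := by
      rcases hm with rfl | rfl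
      exacts [Iff.rfl, hU.symm]
    rw [key m hm]
    constructor
    · intro hmU
      have h1 := (hx i).1 (hmi.1 hmU)
      have h2 := (hx j).1 (hU.1 (hmi.1 hmU))
      linarith
    · intro hmU
      have h1 := (hx i).2 (fun hi => hmU (hmi.2 hi))
      have h2 := (hx j).2 (fun hj => hmU (hmi.2 (hU.2 hj)))
      linarith
  · rw [not_or] at hm
    rw [h.2.2 m hm.1 hm.2]
    exact hx m

end IsPairAverage

/-- Between two values of a finite family at distance at least `card ι * g` there is a gap of
length `g`. -/
theorem exists_gap_of_card_mul_le_sub {ι : Type*} [Fintype ι] {x : ι → ℝ} {p q : ι} {g : ℝ}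
    (hg : 0 < g) (hpq : Fintype.card ι * g ≤ x p - x q) :
    ∃ c, x q ≤ c ∧ c < x p ∧ ∀ m, c < x m → c + g < x m := by
  by_contra! hcon
  have hk : ∀ k : Fin (Fintype.card ι),
      ∃ m, x q + (k : ℕ) * g < x m ∧ x m ≤ x q + (k : ℕ) * g + g := by
    intro k
    have hlt : ((k : ℕ) : ℝ) * g < Fintype.card ι * g :=
      mul_lt_mul_of_pos_right (by exact_mod_cast k.2) hg
    exact hcon _ (le_add_of_nonneg_right (by positivity)) (by linarith)
  choose f hf1 hf2 using hk
  have hle : ∀ k l, f k = f l → (k : ℕ) ≤ l := by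
    intro k l hkl
    by_contra! hlk
    have h1 : ((l : ℕ) : ℝ) + 1 ≤ (k : ℕ) := by exact_mod_cast hlk
    have h2 := mul_le_mul_of_nonneg_right h1 hg.le
    have h3 := hf1 k
    have h4 := hf2 l
    rw [hkl] at h3
    linarith
  have hinj : Function.Injective f := fun k l hkl =>
    Fin.ext (le_antisymm (hle k l hkl) (hle l k hkl.symm))
  have hbij : Function.Bijective f :=
    (Fintype.bijective_iff_injective_and_card f).2 ⟨hinj, by simp⟩
  obtain ⟨k, hkq⟩ := hbij.2 q
  have h1 := hf1 k
  rw [hkq] at h1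
  have h2 : (0 : ℝ) ≤ (k : ℕ) * g := by positivity
  linarith

/-- A finite family with sum zero has two values whose distance is at least the root mean
square. -/
theorem exists_card_mul_sq_sub_ge_sum_sq {ι : Type*} [Fintype ι] [Nonempty ι] {x : ι → ℝ}
    (hx : ∑ m, x m = 0) :
    ∃ p q, x q ≤ x p ∧ ∑ m, x m ^ 2 ≤ Fintype.card ι * (x p - x q) ^ 2 := by
  obtain ⟨p, -, hp⟩ := Finset.exists_max_image Finset.univ (fun m => x m) Finset.univ_nonempty
  obtain ⟨q, -, hq⟩ := Finset.exists_min_image Finset.univ (fun m => x m) Finset.univ_nonempty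
  have hp0 : 0 ≤ x p := by
    by_contra! h
    have := Finset.sum_neg (fun m hm => (hp m hm).trans_lt h) Finset.univ_nonempty
    exact this.ne hx
  have hq0 : x q ≤ 0 := by
    by_contra! h
    have := Finset.sum_pos (fun m hm => h.trans_le (hq m hm)) Finset.univ_nonempty
    exact this.ne' hx
  refine ⟨p, q, hq0.trans hp0, ?_⟩
  have := Finset.sum_le_card_nsmul Finset.univ (fun m => x m ^ 2) ((x p - x q) ^ 2) (by
    intro m hm
    have h1 := hp m hm
    have h2 := hq m hm
    exact sq_le_sq' (by linarith) (by linarith))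
  simpa [nsmul_eq_mul] using this

section Averaging

variable {ι : Type*} {x : ℕ → ι → ℝ} {i j : ℕ → ι}

/-- If the values at time `T` have a gap of length `g`, then at some later time a pair at distance
at least `g` is averaged. -/
theorem exists_ge_sq_sub_of_gap (hstep : ∀ t, IsPairAverage (i t) (j t) (x t) (x (t + 1)))
    (hfair : ∀ p q, p ≠ q → {t | (i t = p ∧ j t = q) ∨ (i t = q ∧ j t = p)}.Infinite)
    {T : ℕ} {c g : ℝ} (hg : 0 < g) {p q : ι} (hq : x T q ≤ c) (hp : c < x T p)
    (hgap : ∀ m, c < x T m → c + g < x T m) :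
    ∃ t, T ≤ t ∧ g ^ 2 ≤ (x t (i t) - x t (j t)) ^ 2 := by
  by_contra! hcon
  set U : Set ι := {m | c < x T m}
  have hinv : ∀ t, T ≤ t → ∀ m, (m ∈ U → c + g < x t m) ∧ (m ∉ U → x t m ≤ c) := by
    intro t ht
    induction t, ht using Nat.le_induction with
    | base => exact fun m => ⟨hgap m, fun hm => not_lt.1 hm⟩
    | succ t ht ih =>
      refine (hstep t).separated ?_ ih
      have h := abs_lt_of_sq_lt_sq (hcon t ht) hg.le
      rw [abs_lt] at h
      constructor
      · intro hi
        by_contra hj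
        have h1 := (ih _).1 hi
        have h2 := (ih _).2 hj
        linarith
      · intro hj
        by_contra hi
        have h1 := (ih _).1 hj
        have h2 := (ih _).2 hi
        linarith
  have hne : p ≠ q := by
    rintro rfl
    linarith
  obtain ⟨t, ht, hTt⟩ := (hfair p q hne).exists_gt T
  have h1 := (hinv t hTt.le p).1 hp
  have h2 := (hinv t hTt.le q).2 (not_lt.2 hq)
  have h := abs_lt_of_sq_lt_sq (hcon t hTt.le) hg.le
  rw [abs_lt] at h
  rcases ht with ⟨hi, hj⟩ | ⟨hi, hj⟩ <;> rw [hi, hj] at h <;> linarith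

theorem tendsto_zero_of_isPairAverage [Fintype ι] (hij : ∀ t, i t ≠ j t)
    (hstep : ∀ t, IsPairAverage (i t) (j t) (x t) (x (t + 1)))
    (hfair : ∀ p q, p ≠ q → {t | (i t = p ∧ j t = q) ∨ (i t = q ∧ j t = p)}.Infinite)
    (h0 : ∑ m, x 0 m = 0) (m : ι) : Tendsto (fun t => x t m) atTop (𝓝 0) := by
  have : Nonempty ι := ⟨m⟩
  have hsum : ∀ t, ∑ m, x t m = 0 := by
    intro t
    induction t with
    | zero => exact h0
    | succ t ih => rw [(hstep t).sum_eq (hij t), ih]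
  set V : ℕ → ℝ := fun t => ∑ m, x t m ^ 2
  have hVstep : ∀ t, V (t + 1) = V t - (x t (i t) - x t (j t)) ^ 2 / 2 :=
    fun t => (hstep t).sum_sq_eq (hij t)
  have hVanti : Antitone V := antitone_nat_of_succ_le fun t => by
    rw [hVstep]
    linarith [sq_nonneg (x t (i t) - x t (j t))]
  have hV0 : ∀ t, 0 ≤ V t := fun t => Finset.sum_nonneg fun m _ => sq_nonneg _
  have hbdd : BddBelow (Set.range V) := ⟨0, by rintro _ ⟨t, rfl⟩; exact hV0 t⟩
  obtain ⟨v, hv⟩ : ∃ v, Tendsto V atTop (𝓝 v) := ⟨_, tendsto_atTop_ciInf hVanti hbdd⟩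
  have hvle : ∀ t, v ≤ V t := hVanti.le_of_tendsto hv
  have hv_zero : v = 0 := by
    refine le_antisymm ?_ (ge_of_tendsto' hv hV0)
    by_contra! hvpos
    set N : ℝ := (Fintype.card ι : ℝ)
    have hNpos : 0 < N := Nat.cast_pos.2 Fintype.card_pos
    obtain ⟨T, hT⟩ := (hv.eventually_lt_const
      (show v < v + v / N ^ 3 / 2 by linarith [show 0 < v / N ^ 3 by positivity])).exists
    obtain ⟨p, q, hqp, hpq⟩ := exists_card_mul_sq_sub_ge_sum_sq (hsum T)
    have hD : v ≤ N * (x T p - x T q) ^ 2 := (hvle T).trans hpq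
    have hDpos : 0 < x T p - x T q := by
      refine lt_of_le_of_ne (sub_nonneg.2 hqp) fun h => ?_
      rw [← h] at hD
      norm_num at hD
      linarith
    set g := (x T p - x T q) / N
    have hg : 0 < g := div_pos hDpos hNpos
    have hNg : N * g = x T p - x T q := mul_div_cancel₀ _ hNpos.ne'
    obtain ⟨c, hc1, hc2, hc3⟩ := exists_gap_of_card_mul_le_sub hg hNg.le
    obtain ⟨t, hTt, ht⟩ := exists_ge_sq_sub_of_gap hstep hfair hg hc1 hc2 hc3
    have h1 : v / N ^ 3 ≤ g ^ 2 := by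
      rw [div_le_iff₀ (by positivity)]
      rw [← hNg] at hD
      linarith
    have h2 := hVstep t
    have h3 := hvle (t + 1)
    have h4 := hVanti hTt
    linarith
  rw [hv_zero] at hv
  have hsq : Tendsto (fun t => x t m ^ 2) atTop (𝓝 0) :=
    squeeze_zero (fun t => sq_nonneg _) (fun t =>
      Finset.single_le_sum (f := fun m => x t m ^ 2) (fun m _ => sq_nonneg _)
        (Finset.mem_univ m)) hv
  rw [tendsto_zero_iff_abs_tendsto_zero]
  have := hsq.sqrt
  simpa [Real.sqrt_sq_eq_abs, Function.comp_def] using this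

end Averaging

/-- Claim 4.5 of the paper (evaluated pointwise): iterated pairwise geometric averaging of
values in `[0,1]`, with every unordered pair of distinct indices selected infinitely often,
converges at every coordinate to the geometric mean of the initial values. -/
theorem pairwise_geometric_averaging_tendsto_geometricMean
    (n : ℕ) (hn : 1 ≤ n)
    (a : ℕ → Fin n → ℝ) (ha0 : ∀ m, a 0 m ∈ Set.Icc (0 : ℝ) 1)
    (i j : ℕ → Fin n) (hij : ∀ t, i t ≠ j t)
    (hrec : ∀ t, a (t + 1) (i t) = Real.sqrt (a t (i t) * a t (j t)) ∧
      a (t + 1) (j t) = Real.sqrt (a t (i t) * a t (j t)) ∧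
      ∀ m, m ≠ i t → m ≠ j t → a (t + 1) m = a t m)
    (hfair : ∀ p q : Fin n, p ≠ q →
      {t : ℕ | (i t = p ∧ j t = q) ∨ (i t = q ∧ j t = p)}.Infinite) :
    ∀ m : Fin n, Filter.Tendsto (fun t => a t m) Filter.atTop
      (nhds ((∏ l, a 0 l) ^ (1 / (n : ℝ)))) := by
  intro m
  have hn0 : (n : ℝ) ≠ 0 := by exact_mod_cast (Nat.one_le_iff_ne_zero.1 hn)
  by_cases hzero : ∃ p, a 0 p = 0
  · obtain ⟨p, hp⟩ := hzero
    have hstay : ∀ k t, a t k = 0 → a (t + 1) k = 0 := by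
      intro k t hk
      by_cases hi : k = i t
      · rw [hi, (hrec t).1, ← hi, hk, zero_mul, Real.sqrt_zero]
      by_cases hj : k = j t
      · rw [hj, (hrec t).2.1, ← hj, hk, mul_zero, Real.sqrt_zero]
      rw [(hrec t).2.2 k hi hj, hk]
    have hstay' : ∀ k s t, s ≤ t → a s k = 0 → a t k = 0 := by
      intro k s t hst hk
      induction t, hst using Nat.le_induction with
      | base => exact hk
      | succ t _ ih => exact hstay k t ih
    obtain ⟨s, hs⟩ : ∃ s, a s m = 0 := by
      rcases eq_or_ne p m with rfl | hpm
      · exact ⟨0, hp⟩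
      obtain ⟨t, ht⟩ := (hfair p m hpm).nonempty
      have hpt := hstay' p 0 t (Nat.zero_le t) hp
      refine ⟨t + 1, ?_⟩
      rcases ht with ⟨hi, hj⟩ | ⟨hi, hj⟩
      · rw [← hj, (hrec t).2.1, hi, hpt, zero_mul, Real.sqrt_zero]
      · rw [← hi, (hrec t).1, hj, hpt, mul_zero, Real.sqrt_zero]
    rw [Finset.prod_eq_zero (Finset.mem_univ p) hp, Real.zero_rpow (one_div_ne_zero hn0)]
    exact tendsto_const_nhds.congr' <| (eventually_ge_atTop s).mono fun t ht =>
      (hstay' m s t ht hs).symm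
  · push Not at hzero
    have hpos : ∀ t k, 0 < a t k := by
      intro t
      induction t with
      | zero => exact fun k => lt_of_le_of_ne (ha0 k).1 (hzero k).symm
      | succ t ih =>
        intro k
        have hs := Real.sqrt_pos.2 (mul_pos (ih (i t)) (ih (j t)))
        by_cases hi : k = i t
        · rwa [hi, (hrec t).1]
        by_cases hj : k = j t
        · rwa [hj, (hrec t).2.1]
        rw [(hrec t).2.2 k hi hj]
        exact ih k
    set μ : ℝ := (∑ l, Real.log (a 0 l)) / n with hμ
    have hlog : ∀ t, Real.log (Real.sqrt (a t (i t) * a t (j t))) =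
        (Real.log (a t (i t)) + Real.log (a t (j t))) / 2 := fun t => by
      rw [Real.log_sqrt (mul_pos (hpos t _) (hpos t _)).le,
        Real.log_mul (hpos t _).ne' (hpos t _).ne']
    have hlim : Tendsto (fun t => Real.log (a t m) - μ) atTop (𝓝 0) := by
      refine tendsto_zero_of_isPairAverage (x := fun t k => Real.log (a t k) - μ) hij
        (fun t => ⟨?_, ?_, fun k hi hj => ?_⟩) hfair ?_ m
      · simp only [(hrec t).1, hlog]
        ring
      · simp only [(hrec t).2.1, hlog]
        ring
      · simp only [(hrec t).2.2 k hi hj]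
      · rw [Finset.sum_sub_distrib]
        simp [hμ, mul_div_cancel₀ _ hn0]
    have hmean : (∏ l, a 0 l) ^ (1 / (n : ℝ)) = Real.exp (0 + μ) := by
      rw [Real.rpow_def_of_pos (Finset.prod_pos fun l _ => hpos 0 l),
        Real.log_prod fun l _ => (hpos 0 l).ne', zero_add, hμ, mul_one_div]
    rw [hmean]
    refine ((Real.continuous_exp.tendsto _).comp (hlim.add_const μ)).congr fun t => ?_
    simp [Real.exp_log (hpos t m)]
end

section
/- Let n ≥ 1 and let i, k be integers with 1 ≤ i < k ≤ n. Let x ∈ [0,1]ⁿ and y ∈ [0,1]. If B_k(x₁, …, xₙ) = B_k(y, …, y), then B_i(x₁, …, xₙ) ≤ B_i(y, …, y). -/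
/-- The probability that independent Bernoulli trials indexed by `s`, with success probabilities
`x`, produce fewer than `t` successes, for an integer threshold `t`. -/
noncomputable def trialCDF {ι : Type*} [DecidableEq ι] (s : Finset ι) (x : ι → ℝ) (t : ℤ) : ℝ :=
  ∑ A ∈ s.powerset, if (A.card : ℤ) < t then (∏ j ∈ A, x j) * ∏ j ∈ s \ A, (1 - x j) else 0

/-- The probability of exactly `t` successes among the trials indexed by `s`. -/
noncomputable def trialPMF {ι : Type*} [DecidableEq ι] (s : Finset ι) (x : ι → ℝ) (t : ℤ) : ℝ :=
  trialCDF s x (t + 1) - trialCDF s x t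

section Trials

variable {ι : Type*} [DecidableEq ι]

lemma trialCDF_congr {s : Finset ι} {x y : ι → ℝ} (h : ∀ j ∈ s, x j = y j) (t : ℤ) :
    trialCDF s x t = trialCDF s y t := by
  unfold trialCDF
  refine Finset.sum_congr rfl fun A hA => ?_
  rw [Finset.mem_powerset] at hA
  rw [Finset.prod_congr rfl fun j hj => h j (hA hj),
    Finset.prod_congr rfl fun j hj => congrArg (1 - ·) (h j (Finset.mem_sdiff.1 hj).1)]

lemma trialCDF_empty (x : ι → ℝ) (t : ℤ) :
    trialCDF ∅ x t = if 0 < t then 1 else 0 := by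
  simp [trialCDF]

lemma trialCDF_insert {a : ι} {s : Finset ι} (ha : a ∉ s) (x : ι → ℝ) (t : ℤ) :
    trialCDF (insert a s) x t =
      (1 - x a) * trialCDF s x t + x a * trialCDF s x (t - 1) := by
  unfold trialCDF
  rw [Finset.sum_powerset_insert ha, Finset.mul_sum, Finset.mul_sum]
  congr 1
  · refine Finset.sum_congr rfl fun A hA => ?_
    have haA : a ∉ A := fun h => ha (Finset.mem_powerset.1 hA h)
    rw [Finset.insert_sdiff_of_notMem _ haA, Finset.prod_insert (by simp [ha])]
    split_ifs <;> ring
  · refine Finset.sum_congr rfl fun A hA => ?_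
    have haA : a ∉ A := fun h => ha (Finset.mem_powerset.1 hA h)
    have hsd : insert a s \ insert a A = s \ A := by
      ext j
      simp only [Finset.mem_sdiff, Finset.mem_insert]
      grind
    rw [hsd, Finset.prod_insert haA, Finset.card_insert_of_notMem haA]
    have hlt : ((A.card + 1 : ℕ) : ℤ) < t ↔ (A.card : ℤ) < t - 1 := by
      push_cast
      omega
    simp only [hlt]
    split_ifs <;> ring

lemma trialCDF_of_nonpos (s : Finset ι) (x : ι → ℝ) {t : ℤ} (ht : t ≤ 0) :
    trialCDF s x t = 0 :=
  Finset.sum_eq_zero fun A _ => if_neg (by omega)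

lemma trialCDF_of_card_lt (s : Finset ι) (x : ι → ℝ) {t : ℤ} (ht : (s.card : ℤ) < t) :
    trialCDF s x t = 1 := by
  induction s using Finset.induction_on generalizing t with
  | empty => rw [trialCDF_empty, if_pos (by simpa using ht)]
  | insert a s ha ih =>
    rw [Finset.card_insert_of_notMem ha] at ht
    push_cast at ht
    rw [trialCDF_insert ha, ih (by omega), ih (by omega)]
    ring

lemma trialPMF_empty (x : ι → ℝ) (t : ℤ) :
    trialPMF ∅ x t = if t = 0 then 1 else 0 := by
  simp only [trialPMF, trialCDF_empty]
  split_ifs <;> first | omega | norm_num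

lemma trialPMF_insert {a : ι} {s : Finset ι} (ha : a ∉ s) (x : ι → ℝ) (t : ℤ) :
    trialPMF (insert a s) x t =
      (1 - x a) * trialPMF s x t + x a * trialPMF s x (t - 1) := by
  simp only [trialPMF, trialCDF_insert ha, sub_add_cancel, add_sub_cancel_right]
  ring

lemma trialPMF_nonneg (s : Finset ι) {x : ι → ℝ} (hx : ∀ j, x j ∈ Set.Icc (0 : ℝ) 1) (t : ℤ) :
    0 ≤ trialPMF s x t := by
  induction s using Finset.induction_on generalizing t with
  | empty => rw [trialPMF_empty]; positivity
  | insert a s ha ih =>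
    rw [trialPMF_insert ha]
    exact add_nonneg (mul_nonneg (sub_nonneg.2 (hx a).2) (ih t)) (mul_nonneg (hx a).1 (ih _))

lemma trialPMF_pos (s : Finset ι) {x : ι → ℝ} (hx : ∀ j, x j ∈ Set.Ioo (0 : ℝ) 1) {t : ℤ}
    (h0 : 0 ≤ t) (ht : t ≤ s.card) : 0 < trialPMF s x t := by
  induction s using Finset.induction_on generalizing t with
  | empty =>
    rw [trialPMF_empty, if_pos (le_antisymm (by simpa using ht) h0)]
    exact one_pos
  | insert a s ha ih =>
    have hnn := trialPMF_nonneg s (fun j => Set.Ioo_subset_Icc_self (hx j))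
    rw [Finset.card_insert_of_notMem ha] at ht
    push_cast at ht
    rw [trialPMF_insert ha]
    have h1 := sub_pos.2 (hx a).2
    rcases h0.eq_or_lt with rfl | hpos
    · exact add_pos_of_pos_of_nonneg (mul_pos h1 (ih le_rfl (by omega)))
        (mul_nonneg (hx a).1.le (hnn _))
    · exact add_pos_of_nonneg_of_pos (mul_nonneg h1.le (hnn _))
        (mul_pos (hx a).1 (ih (by omega) (by omega)))

lemma trialCDF_mono (s : Finset ι) {x : ι → ℝ} (hx : ∀ j, x j ∈ Set.Icc (0 : ℝ) 1) :
    Monotone (trialCDF s x) :=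
  monotone_int_of_le_succ fun t => sub_nonneg.1 (trialPMF_nonneg s hx t)

lemma trialCDF_le_one (s : Finset ι) {x : ι → ℝ} (hx : ∀ j, x j ∈ Set.Icc (0 : ℝ) 1) (t : ℤ) :
    trialCDF s x t ≤ 1 := by
  rw [← trialCDF_of_card_lt s x (t := max t (s.card + 1)) (by simp)]
  exact trialCDF_mono s hx (le_max_left _ _)

/-- The number of successes has a log-concave distribution. -/
lemma trialPMF_mul_le (s : Finset ι) {x : ι → ℝ} (hx : ∀ j, x j ∈ Set.Icc (0 : ℝ) 1)
    {a d : ℤ} (had : a ≤ d) :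
    trialPMF s x a * trialPMF s x (d + 1) ≤ trialPMF s x (a + 1) * trialPMF s x d := by
  induction s using Finset.induction_on generalizing a d with
  | empty =>
    simp only [trialPMF_empty]
    split_ifs <;> first | omega | norm_num
  | insert b s hb ih =>
    simp only [trialPMF_insert hb, add_sub_cancel_right]
    set q := trialPMF s x
    have outer : q a * q (d + 1) ≤ q (a + 1) * q d := ih had
    have inner : q (a - 1) * q d ≤ q a * q (d - 1) := by
      simpa using ih (a := a - 1) (d := d - 1) (by omega)
    have cross : q (a - 1) * q (d + 1) ≤ q (a + 1) * q (d - 1) := by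
      rcases had.eq_or_lt with rfl | hlt
      · rw [mul_comm]
      · calc q (a - 1) * q (d + 1) ≤ q a * q d := by
              simpa using ih (a := a - 1) (d := d) (by omega)
          _ ≤ q (a + 1) * q (d - 1) := by
              simpa using ih (a := a) (d := d - 1) (by omega)
    have h0 := (hx b).1
    have h1 := sub_nonneg.2 (hx b).2
    have e1 := mul_le_mul_of_nonneg_left outer (mul_nonneg h1 h1)
    have e2 := mul_le_mul_of_nonneg_left cross (mul_nonneg h0 h1)
    have e3 := mul_le_mul_of_nonneg_left inner (mul_nonneg h0 h0)
    linarith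

/-- Two consecutive zeros of the mass function leave no mass on one of their two sides. -/
lemma trialCDF_eq_zero_or_one (s : Finset ι) {x : ι → ℝ} (hx : ∀ j, x j ∈ Set.Icc (0 : ℝ) 1)
    {m : ℤ} (h0 : trialPMF s x m = 0) (h1 : trialPMF s x (m + 1) = 0) :
    trialCDF s x m = 0 ∨ trialCDF s x m = 1 := by
  have hnn := trialPMF_nonneg s hx
  have hmul : ∀ d, m ≤ d → ∀ a ≤ m + 1, trialPMF s x a * trialPMF s x d = 0 := by
    intro d hd
    induction d, hd using Int.leInduction with
    | base => simp [h0]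
    | succ d hd ih =>
      intro a ha
      rcases ha.eq_or_lt with rfl | hlt
      · simp [h1]
      · exact le_antisymm ((trialPMF_mul_le s hx (by omega)).trans (ih _ (by omega)).le)
          (mul_nonneg (hnn _) (hnn _))
  by_cases hlow : ∀ a ≤ m + 1, trialPMF s x a = 0
  · left
    rcases le_total m 0 with hm | hm
    · exact trialCDF_of_nonpos s x hm
    · have hz : ∀ t, 0 ≤ t → t ≤ m → trialCDF s x t = 0 := by
        intro t ht
        induction t, ht using Int.leInduction with
        | base => exact fun _ => trialCDF_of_nonpos s x le_rfl
        | succ t ht ih =>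
          intro htm
          have := hlow t (by omega)
          rw [trialPMF, ih (by omega)] at this
          linarith
      exact hz m hm le_rfl
  · right
    push Not at hlow
    obtain ⟨a, ha, hqa⟩ := hlow
    have hconst : ∀ t, m ≤ t → trialCDF s x t = trialCDF s x m := by
      intro t ht
      induction t, ht using Int.leInduction with
      | base => rfl
      | succ t ht ih =>
        have := (mul_eq_zero.1 (hmul t ht a ha)).resolve_left hqa
        rw [trialPMF, ih] at this
        linarith
    rw [← hconst (max m (s.card + 1)) (le_max_left _ _)]
    exact trialCDF_of_card_lt s x (by simp)

lemma trialCDF_antitone (s : Finset ι) {x y : ι → ℝ} (hx : ∀ j, x j ∈ Set.Icc (0 : ℝ) 1)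
    (hy : ∀ j, y j ∈ Set.Icc (0 : ℝ) 1) (h : ∀ j ∈ s, x j ≤ y j) (t : ℤ) :
    trialCDF s y t ≤ trialCDF s x t := by
  induction s using Finset.induction_on generalizing t with
  | empty => simp [trialCDF_empty]
  | insert a s ha ih =>
    have ih' := ih fun j hj => h j (Finset.mem_insert_of_mem hj)
    rw [trialCDF_insert ha, trialCDF_insert ha]
    have e1 := mul_le_mul_of_nonneg_left (ih' t) (sub_nonneg.2 (hy a).2)
    have e2 := mul_le_mul_of_nonneg_left (ih' (t - 1)) (hy a).1
    have e3 := mul_nonneg (sub_nonneg.2 (h a (Finset.mem_insert_self a s)))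
      (sub_nonneg.2 (trialCDF_mono s hx (show t - 1 ≤ t by omega)))
    linarith

lemma trialCDF_lt_of_le_of_lt {s : Finset ι} {x : ι → ℝ} (hx : ∀ j, x j ∈ Set.Icc (0 : ℝ) 1)
    {y : ℝ} (hy : y ∈ Set.Ioo (0 : ℝ) 1) (h : ∀ j ∈ s, x j ≤ y) {a : ι} (ha : a ∈ s)
    (hlt : x a < y) {t : ℤ} (h1 : 1 ≤ t) (ht : t ≤ s.card) :
    trialCDF s (fun _ => y) t < trialCDF s x t := by
  have hcard := Finset.card_erase_add_one ha
  have hpos : 0 < trialPMF (s.erase a) (fun _ => y) (t - 1) :=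
    trialPMF_pos _ (fun _ => hy) (by omega) (by omega)
  have hmono := trialCDF_antitone (s.erase a) hx (fun _ => Set.Ioo_subset_Icc_self hy)
    fun j hj => h j (Finset.mem_of_mem_erase hj)
  rw [← Finset.insert_erase ha, trialCDF_insert (Finset.notMem_erase a s),
    trialCDF_insert (Finset.notMem_erase a s)]
  rw [trialPMF, sub_add_cancel] at hpos
  have e1 := mul_le_mul_of_nonneg_left (hmono t) (sub_nonneg.2 (hx a).2)
  have e2 := mul_le_mul_of_nonneg_left (hmono (t - 1)) (hx a).1
  have e3 := mul_pos (sub_pos.2 hlt) hpos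
  linarith

lemma trialCDF_mem_Ioo (s : Finset ι) {x : ι → ℝ} (hx : ∀ j, x j ∈ Set.Ioo (0 : ℝ) 1) {t : ℤ}
    (h1 : 1 ≤ t) (ht : t ≤ s.card) : trialCDF s x t ∈ Set.Ioo (0 : ℝ) 1 := by
  have hx' := fun j => Set.Ioo_subset_Icc_self (hx j)
  constructor
  · have h := trialPMF_pos s hx (t := 0) le_rfl (by omega)
    rw [trialPMF, trialCDF_of_nonpos s x le_rfl, sub_zero, zero_add] at h
    exact h.trans_le (trialCDF_mono s hx' h1)
  · have h := trialPMF_pos s hx (t := t) (by omega) ht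
    exact (sub_pos.1 h).trans_le (trialCDF_le_one s hx' _)

lemma trialCDF_insert_insert {a b : ι} {s : Finset ι} (hab : a ≠ b) (ha : a ∉ s) (hb : b ∉ s)
    (x : ι → ℝ) (t : ℤ) :
    trialCDF (insert a (insert b s)) x t = trialCDF s x t
      - trialPMF s x (t - 1) * (x a + x b - x a * x b)
      - trialPMF s x (t - 2) * (x a * x b) := by
  rw [trialCDF_insert (by simp [hab, ha]), trialCDF_insert hb, trialCDF_insert hb, trialPMF,
    trialPMF, sub_add_cancel, show t - 1 - 1 = t - 2 by ring, show t - 2 + 1 = t - 1 by ring]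
  ring

lemma trialCDF_zero_eq_one (s : Finset ι) {t : ℤ} (ht : 1 ≤ t) :
    trialCDF s (fun _ => 0) t = 1 := by
  induction s using Finset.induction_on with
  | empty => rw [trialCDF_empty, if_pos (by omega)]
  | insert a s ha ih => simp [trialCDF_insert ha, ih]

lemma trialCDF_one_eq_zero (s : Finset ι) {t : ℤ} (ht : t ≤ s.card) :
    trialCDF s (fun _ => 1) t = 0 := by
  induction s using Finset.induction_on generalizing t with
  | empty => exact trialCDF_of_nonpos _ _ (by simpa using ht)
  | insert a s ha ih =>
    rw [Finset.card_insert_of_notMem ha] at ht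
    push_cast at ht
    simp [trialCDF_insert ha, ih (t := t - 1) (by omega)]

end Trials

/-- On a level set of the bilinear expression with nonnegative coefficients `α`, `β`, one of two
numbers `u ≤ y ≤ w` can be moved to `y` while the other stays between them. -/
lemma exists_mem_Icc_bilinear_eq {α β u y w : ℝ} (hα : 0 ≤ α) (hβ : 0 ≤ β) (hu : 0 ≤ u)
    (huy : u ≤ y) (hyw : y ≤ w) (hw : w ≤ 1) :
    ∃ v ∈ Set.Icc u w, α * (y + v - y * v) + β * (y * v) = α * (u + w - u * w) + β * (u * w) := by
  have hc : ContinuousOn (fun v : ℝ => α * (y + v - y * v) + β * (y * v)) (Set.Icc u w) := by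
    fun_prop
  refine intermediate_value_Icc (huy.trans hyw) hc ⟨?_, ?_⟩
  · have e1 := mul_nonneg hα (mul_nonneg (sub_nonneg.2 hyw)
      (sub_nonneg.2 (huy.trans (hyw.trans hw))))
    have e2 := mul_nonneg hβ (mul_nonneg (sub_nonneg.2 hyw) hu)
    linarith
  · have e1 := mul_nonneg hα (mul_nonneg (sub_nonneg.2 huy) (sub_nonneg.2 hw))
    have e2 := mul_nonneg hβ (mul_nonneg (sub_nonneg.2 huy) (hu.trans (huy.trans hyw)))
    linarith

/-- Contracting a pair along a level set of one bilinear expression decreases another one whose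
coefficients have a larger ratio. -/
lemma bilinear_le_of_bilinear_eq {A B α β u y w v : ℝ} (hα : 0 ≤ α)
    (hβ : 0 ≤ β) (hαβ : 0 < α + β) (hlc : B * α ≤ A * β)
    (hy : y ∈ Set.Ioo (0 : ℝ) 1) (huy : u ≤ y) (hyw : y ≤ w)
    (h : α * (y + v - y * v) + β * (y * v) = α * (u + w - u * w) + β * (u * w)) :
    A * (y + v - y * v) + B * (y * v) ≤ A * (u + w - u * w) + B * (u * w) := by
  have hsq := mul_nonneg (sub_nonneg.2 huy) (sub_nonneg.2 hyw)
  obtain ⟨P, hP⟩ : ∃ P, P = y * v - u * w := ⟨_, rfl⟩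
  obtain ⟨R, hR⟩ : ∃ R, R = (u + w - u * w) - (y + v - y * v) := ⟨_, rfl⟩
  have hlin : α * R = β * P := by rw [hP, hR]; linarith
  suffices B * P ≤ A * R by rw [hP, hR] at this; linarith
  have hPR : 0 ≤ P ∧ 0 ≤ R := by
    rcases le_total (u + w) (y + v) with hs | hs
    · have hP0 : 0 ≤ P := by
        have := mul_nonneg hy.1.le (sub_nonneg.2 hs)
        rw [hP]; linarith
      refine ⟨hP0, ?_⟩
      by_contra hneg
      push Not at hneg
      have hα0 : α = 0 := by nlinarith [mul_nonneg hβ hP0]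
      have hPz : P = 0 := by
        rw [hα0, zero_mul, eq_comm, mul_eq_zero] at hlin
        exact hlin.resolve_left (by linarith)
      have : y * (y + v - (u + w)) ≤ 0 := by rw [hP] at hPz; linarith
      have : y + v - (u + w) ≤ 0 := nonpos_of_mul_nonpos_right this hy.1
      rw [hR] at hneg; rw [hP] at hPz; linarith
    · have hR0 : 0 ≤ R := by
        have := mul_nonneg (sub_nonneg.2 hy.2.le) (sub_nonneg.2 hs)
        rw [hR]; linarith
      refine ⟨?_, hR0⟩
      by_contra hneg
      push Not at hneg
      have hβ0 : β = 0 := by nlinarith [mul_nonneg hα hR0]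
      have hRz : R = 0 := by
        rw [hβ0, zero_mul, mul_eq_zero] at hlin
        exact hlin.resolve_left (by linarith)
      have : (1 - y) * (u + w - (y + v)) ≤ 0 := by rw [hR] at hRz; linarith
      have : u + w - (y + v) ≤ 0 := nonpos_of_mul_nonpos_right this (sub_pos.2 hy.2)
      rw [hP] at hneg; rw [hR] at hRz; linarith
  refine le_of_mul_le_mul_left ?_ hαβ
  have e1 := mul_le_mul_of_nonneg_right hlc hPR.1
  have e2 := mul_le_mul_of_nonneg_right hlc hPR.2
  have e3 : A * (α * R) = A * (β * P) := by rw [hlin]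
  have e4 : B * (α * R) = B * (β * P) := by rw [hlin]
  linarith

lemma trialCDF_le_of_eq_at_larger_index {ι : Type*} [DecidableEq ι] {s : Finset ι} {i k : ℤ}
    (hi : 1 ≤ i) (hik : i < k) (hks : k ≤ s.card) {x : ι → ℝ}
    (hx : ∀ j, x j ∈ Set.Icc (0 : ℝ) 1) {y : ℝ} (hy : y ∈ Set.Ioo (0 : ℝ) 1)
    (heq : trialCDF s x k = trialCDF s (fun _ => y) k) :
    trialCDF s x i ≤ trialCDF s (fun _ => y) i := by
  induction hN : (s.filter fun j => x j ≠ y).card using Nat.strong_induction_on generalizing x with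
  | _ N ih =>
  have hy' : ∀ _ : ι, y ∈ Set.Icc (0 : ℝ) 1 := fun _ => Set.Ioo_subset_Icc_self hy
  by_cases hge : ∀ j ∈ s, y ≤ x j
  · exact trialCDF_antitone s hy' hx hge i
  push Not at hge
  obtain ⟨a, ha, hay⟩ := hge
  by_cases hle : ∀ j ∈ s, x j ≤ y
  · exact absurd heq (trialCDF_lt_of_le_of_lt hx hy hle ha hay (by omega) hks).ne'
  push Not at hle
  obtain ⟨b, hb, hyb⟩ := hle
  have hab : a ≠ b := by rintro rfl; exact lt_asymm hay hyb
  obtain ⟨r, har, hbr, hs⟩ : ∃ r, a ∉ r ∧ b ∉ r ∧ s = insert a (insert b r) := by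
    refine ⟨(s.erase a).erase b, by simp, by simp, ?_⟩
    rw [Finset.insert_erase (Finset.mem_erase.2 ⟨hab.symm, hb⟩), Finset.insert_erase ha]
  have hnn := trialPMF_nonneg r hx
  have hsum : 0 < trialPMF r x (k - 1) + trialPMF r x (k - 2) := by
    refine (add_nonneg (hnn _) (hnn _)).lt_of_ne fun hzero => ?_
    have h1 : trialPMF r x (k - 1) = 0 := by linarith [hnn (k - 1), hnn (k - 2)]
    have h2 : trialPMF r x (k - 2) = 0 := by linarith [hnn (k - 1), hnn (k - 2)]
    have hmid := trialCDF_mem_Ioo s (fun _ => hy) (show 1 ≤ k by omega) hks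
    have hk1 : k - 2 + 1 = k - 1 := by ring
    rw [← heq, hs, trialCDF_insert_insert hab har hbr, h1, h2, zero_mul, zero_mul, sub_zero,
      sub_zero] at hmid
    have hconst : trialCDF r x k = trialCDF r x (k - 2) := by
      rw [trialPMF, sub_add_cancel] at h1
      rw [trialPMF, hk1] at h2
      linarith
    rw [hconst] at hmid
    rcases trialCDF_eq_zero_or_one r hx h2 (by rw [hk1, h1]) with h | h
    · exact hmid.1.ne' h
    · exact hmid.2.ne h
  obtain ⟨v, hv, hlevel⟩ := exists_mem_Icc_bilinear_eq (hnn (k - 1)) (hnn (k - 2)) (hx a).1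
    hay.le hyb.le (hx b).2
  have hlc : trialPMF r x (i - 2) * trialPMF r x (k - 1) ≤
      trialPMF r x (i - 1) * trialPMF r x (k - 2) := by
    have := trialPMF_mul_le r hx (show i - 2 ≤ k - 2 by omega)
    rwa [show k - 2 + 1 = k - 1 by ring, show i - 2 + 1 = i - 1 by ring] at this
  have himp := bilinear_le_of_bilinear_eq (hnn (k - 1)) (hnn (k - 2)) hsum
    hlc hy hay.le hyb.le hlevel
  obtain ⟨z, hz⟩ : ∃ z, z = Function.update (Function.update x a y) b v := ⟨_, rfl⟩
  have hza : z a = y := by simp [hz, hab]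
  have hzb : z b = v := by simp [hz]
  have hzo : ∀ j, j ≠ a → j ≠ b → z j = x j := fun j h1 h2 => by simp [hz, h1, h2]
  have hzr : ∀ t, trialCDF r z t = trialCDF r x t := trialCDF_congr fun j hj =>
    hzo j (ne_of_mem_of_not_mem hj har) (ne_of_mem_of_not_mem hj hbr)
  have hzs : ∀ t, trialCDF s z t = trialCDF r x t
      - trialPMF r x (t - 1) * (y + v - y * v) - trialPMF r x (t - 2) * (y * v) := by
    intro t
    rw [hs, trialCDF_insert_insert hab har hbr, hza, hzb]
    simp only [trialPMF, hzr]
  have hzI : ∀ j, z j ∈ Set.Icc (0 : ℝ) 1 := by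
    intro j
    by_cases hja : j = a
    · rw [hja, hza]; exact hy' a
    by_cases hjb : j = b
    · rw [hjb, hzb]; exact ⟨(hx a).1.trans hv.1, hv.2.trans (hx b).2⟩
    rw [hzo j hja hjb]; exact hx j
  have hcard : (s.filter fun j => z j ≠ y).card < N := by
    rw [← hN]
    refine Finset.card_lt_card (Finset.ssubset_iff_of_subset ?_ |>.2 ⟨a, ?_, ?_⟩)
    · intro j
      simp only [Finset.mem_filter]
      rintro ⟨hjs, hj⟩
      refine ⟨hjs, ?_⟩
      by_cases hja : j = a
      · exact hja ▸ hay.ne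
      by_cases hjb : j = b
      · exact hjb ▸ hyb.ne'
      rwa [← hzo j hja hjb]
    · exact Finset.mem_filter.2 ⟨ha, hay.ne⟩
    · simp [hza]
  have hxs := trialCDF_insert_insert hab har hbr x
  rw [← hs] at hxs
  have hzk : trialCDF s z k = trialCDF s x k := by
    rw [hzs, hxs]
    linarith
  calc trialCDF s x i ≤ trialCDF s z i := by
        rw [hzs, hxs]
        linarith
    _ ≤ trialCDF s (fun _ => y) i := ih _ hcard hzI (hzk.trans heq) rfl

lemma bernCDF_eq_trialCDF {n t : ℕ} (ht : 1 ≤ t) (x : Fin n → ℝ) :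
    bernCDF n t x = trialCDF Finset.univ x t := by
  rw [bernCDF, trialCDF, Finset.sum_filter, Finset.powerset_univ]
  refine Finset.sum_congr rfl fun A _ => ?_
  rw [Finset.compl_eq_univ_sdiff]
  exact if_congr (by omega) rfl rfl

/-- First bullet of the paper's Lemma 5.1 (pointwise form): among all Bernoulli parameter
vectors with a prescribed value of the `k`-th order-statistic CDF `B_k`, the `i`-th
order-statistic CDF `B_i` for `i < k` is maximized by the equal-parameter (i.i.d.) vector. -/
theorem bernCDF_le_of_eq_at_larger_index
    (n : ℕ) (hn : 1 ≤ n) (i k : ℕ) (hi : 1 ≤ i) (hik : i < k) (hkn : k ≤ n)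
    (x : Fin n → ℝ) (hx : ∀ j, x j ∈ Set.Icc (0 : ℝ) 1)
    (y : ℝ) (hy : y ∈ Set.Icc (0 : ℝ) 1)
    (heq : bernCDF n k x = bernCDF n k (fun _ => y)) :
    bernCDF n i x ≤ bernCDF n i (fun _ => y) := by
  rw [bernCDF_eq_trialCDF (by omega), bernCDF_eq_trialCDF (by omega)] at heq
  rw [bernCDF_eq_trialCDF hi, bernCDF_eq_trialCDF hi]
  have hcard : (k : ℤ) ≤ (Finset.univ : Finset (Fin n)).card := by simpa using hkn
  rcases hy.1.eq_or_lt with rfl | h0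
  · rw [trialCDF_zero_eq_one _ (by omega)]
    exact trialCDF_le_one _ hx _
  rcases hy.2.eq_or_lt with rfl | h1
  · rw [trialCDF_one_eq_zero _ hcard] at heq
    rw [trialCDF_one_eq_zero _ (by omega), ← heq]
    exact trialCDF_mono _ hx (by omega)
  · exact trialCDF_le_of_eq_at_larger_index (by omega) (by omega) hcard hx ⟨h0, h1⟩ heq
end

section
/- Let n ≥ 1 and let k, i be integers with 1 ≤ k < i ≤ n, and let γ ∈ [0,1]. Define x ∈ [0,1]ⁿ by x_j = (1−γ)^{1/k} for 1 ≤ j ≤ k and x_j = 0 for k < j ≤ n. Then B_k(x) = γ and B_i(x) = 1. -/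
open Finset in
/-- The probabilities of all success sets of independent Bernoulli trials add up to one. -/
theorem sum_bernoulli_weights {n : ℕ} (x : Fin n → ℝ) :
    ∑ A : Finset (Fin n), (∏ j ∈ A, x j) * ∏ j ∈ Aᶜ, (1 - x j) = 1 := by
  simpa using (Fintype.prod_add x (fun j => 1 - x j)).symm

open Finset in
/-- `bernCDF` as one minus the probability of more than `t - 1` successes. -/
theorem bernCDF_eq_one_sub {n : ℕ} (t : ℕ) (x : Fin n → ℝ) :
    bernCDF n t x = 1 - ∑ A : Finset (Fin n) with t - 1 < #A,
      (∏ j ∈ A, x j) * ∏ j ∈ Aᶜ, (1 - x j) := by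
  rw [bernCDF, eq_sub_iff_add_eq]
  refine Eq.trans ?_ (sum_bernoulli_weights x)
  simpa only [not_le] using sum_filter_add_sum_filter_not univ
    (fun A : Finset (Fin n) => #A ≤ t - 1) (fun A => (∏ j ∈ A, x j) * ∏ j ∈ Aᶜ, (1 - x j))

open Finset in
/-- Fewer than `t` trials that can succeed surely give fewer than `t` successes. -/
theorem bernCDF_eq_one_of_card_lt {n t : ℕ} {x : Fin n → ℝ} {S : Finset (Fin n)}
    (hS : #S < t) (hx : ∀ j ∉ S, x j = 0) : bernCDF n t x = 1 := by
  rw [bernCDF_eq_one_sub, sum_eq_zero, sub_zero]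
  intro A hA
  simp only [mem_filter, mem_univ, true_and] at hA
  obtain ⟨j, hjA, hjS⟩ := exists_mem_notMem_of_card_lt_card (show #S < #A by omega)
  rw [prod_eq_zero hjA (hx j hjS), zero_mul]

open Finset in
/-- If only the trials in `S` can succeed, there are fewer than `#S` successes unless all of them
succeed. -/
theorem bernCDF_card_eq_one_sub_prod {n : ℕ} {x : Fin n → ℝ} {S : Finset (Fin n)}
    (hS : S.Nonempty) (hx : ∀ j ∉ S, x j = 0) : bernCDF n #S x = 1 - ∏ j ∈ S, x j := by
  have hpos := hS.card_pos
  rw [bernCDF_eq_one_sub, sum_eq_single_of_mem S (by simpa using hpos)]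
  · rw [prod_eq_one (s := Sᶜ), mul_one]
    intro j hj
    rw [hx j (by simpa using hj), sub_zero]
  · intro A hA hne
    simp only [mem_filter, mem_univ, true_and] at hA
    have hAS : ¬ A ⊆ S := fun h => hne (eq_of_subset_of_card_le h (by omega))
    obtain ⟨j, hjA, hjS⟩ := not_subset.mp hAS
    rw [prod_eq_zero hjA (hx j hjS), zero_mul]

/-- Second bullet of the paper's Lemma 5.1 (construction): for `i > k`, any prescribed value
`γ` of the CDF of the `k`-th order statistic is compatible with the `i`-th order statistic
being at most the threshold with probability `1`, using `k` coordinates equal to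
`(1−γ)^{1/k}` and `n − k` coordinates identically zero. -/
theorem bernCDF_construction_for_larger_index
    (n : ℕ) (hn : 1 ≤ n) (k i : ℕ) (hk : 1 ≤ k) (hki : k < i) (hin : i ≤ n)
    (γ : ℝ) (hγ : γ ∈ Set.Icc (0 : ℝ) 1)
    (x : Fin n → ℝ)
    (hxdef : ∀ j : Fin n, x j = if (j : ℕ) < k then (1 - γ) ^ (1 / (k : ℝ)) else 0) :
    bernCDF n k x = γ ∧ bernCDF n i x = 1 := by
  let S : Finset (Fin n) := {j | (j : ℕ) < k}
  have hcard : S.card = k := by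
    simpa [S, Fin.card_filter_val_lt] using (hki.trans_le hin).le
  have hx : ∀ j ∉ S, x j = 0 := fun j hj => by
    rw [hxdef, if_neg (by simpa [S] using hj)]
  have hprod : ∏ j ∈ S, x j = 1 - γ := by
    have hconst : ∀ j ∈ S, x j = (1 - γ) ^ (1 / (k : ℝ)) := fun j hj => by
      rw [hxdef, if_pos (by simpa [S] using hj)]
    rw [Finset.prod_congr rfl hconst, Finset.prod_const, hcard, one_div,
      Real.rpow_inv_natCast_pow (sub_nonneg.mpr hγ.2) (by omega)]
  refine ⟨?_, bernCDF_eq_one_of_card_lt (hcard.trans_lt hki) hx⟩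
  have h := bernCDF_card_eq_one_sub_prod (Finset.card_pos.mp (by omega)) hx
  rwa [hcard, hprod, sub_sub_cancel] at h
end

section
/- Let b ≤ 1 be a real number and c ∈ ℝ. Suppose x₁, x₂ ∈ [0,1] satisfy b·x₁·x₂ − (x₁ + x₂) = c. Then there exists x ∈ [0,1] with b·x² − 2x = c and x² ≥ x₁·x₂. -/
/-- Pairwise equalization step from the proof of the paper's Lemma 5.1: subject to the
constraint `b·x₁x₂ − (x₁ + x₂) = c` with `b ≤ 1`, any feasible pair `(x₁, x₂) ∈ [0,1]²` is
dominated in product by an equal feasible pair `(x, x) ∈ [0,1]²`. -/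
theorem pairwise_equalization_step
    (b c : ℝ) (hb : b ≤ 1) (x₁ x₂ : ℝ)
    (hx₁ : x₁ ∈ Set.Icc (0 : ℝ) 1) (hx₂ : x₂ ∈ Set.Icc (0 : ℝ) 1)
    (hc : b * x₁ * x₂ - (x₁ + x₂) = c) :
    ∃ x ∈ Set.Icc (0 : ℝ) 1, b * x ^ 2 - 2 * x = c ∧ x₁ * x₂ ≤ x ^ 2 := by
  obtain ⟨h₁, h₁'⟩ := hx₁
  obtain ⟨h₂, h₂'⟩ := hx₂
  have hp : 0 ≤ x₁ * x₂ := mul_nonneg h₁ h₂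
  have hp' : x₁ * x₂ ≤ 1 := mul_le_one₀ h₁' h₂ h₂'
  have hg : 0 ≤ √(x₁ * x₂) := Real.sqrt_nonneg _
  have hsq : √(x₁ * x₂) ^ 2 = x₁ * x₂ := Real.sq_sqrt hp
  have amgm : 2 * √(x₁ * x₂) ≤ x₁ + x₂ :=
    abs_le_of_sq_le_sq' (by nlinarith [sq_nonneg (x₁ - x₂)]) (add_nonneg h₁ h₂) |>.2
  have hcont : ContinuousOn (fun x : ℝ => b * x ^ 2 - 2 * x) (Set.Icc √(x₁ * x₂) 1) := by
    fun_prop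
  obtain ⟨x, ⟨hx, hx'⟩, hfx⟩ :=
    intermediate_value_Icc' (Real.sqrt_le_one.mpr hp') hcont
      (show c ∈ Set.Icc _ _ from
        ⟨by nlinarith [mul_nonneg (sub_nonneg.2 h₁') (sub_nonneg.2 h₂'),
            mul_nonneg (sub_nonneg.2 hb) (sub_nonneg.2 hp')],
          by simp only [hsq]; linarith⟩)
  exact ⟨x, ⟨hg.trans hx, hx'⟩, hfx, hsq ▸ pow_le_pow_left₀ hg hx 2⟩
end

section
/- Fix integers n ≥ 1 and 1 ≤ k ≤ n. Let G : ℝ → [0,1] be nondecreasing and right-continuous with limit 0 at −∞ and limit 1 at +∞ (a cumulative distribution function). Then there exists a unique function F : ℝ → [0,1] such that Σ_{t=0}^{k−1} C(n,t) · (1−F(v))^t · F(v)^{n−t} = G(v) for all v ∈ ℝ; moreover this F is nondecreasing and right-continuous with limit 0 at −∞ and limit 1 at +∞. -/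
open Filter

/-- The probability that the `k`-th order statistic of `n` i.i.d. draws is at most `v`, as a
function of the probability `u` that a single draw is at most `v`. -/
def orderStatisticCDF (n k : ℕ) (u : ℝ) : ℝ :=
  ∑ t ∈ Finset.range k, (n.choose t : ℝ) * (1 - u) ^ t * u ^ (n - t)

theorem continuous_orderStatisticCDF (n k : ℕ) : Continuous (orderStatisticCDF n k) := by
  unfold orderStatisticCDF
  fun_prop

theorem orderStatisticCDF_zero {n k : ℕ} (hkn : k ≤ n) : orderStatisticCDF n k 0 = 0 := by
  refine Finset.sum_eq_zero fun t ht => ?_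
  have ht' := Finset.mem_range.mp ht
  rw [zero_pow (by lia), mul_zero]

theorem orderStatisticCDF_one {n k : ℕ} (hk : 1 ≤ k) : orderStatisticCDF n k 1 = 1 := by
  obtain ⟨j, rfl⟩ := Nat.exists_eq_add_of_le' hk
  simp [orderStatisticCDF, Finset.sum_range_succ']

/-- The derivative of a lower partial sum of binomial probabilities telescopes. -/
theorem hasDerivAt_orderStatisticCDF (m j : ℕ) (u : ℝ) :
    HasDerivAt (orderStatisticCDF (m + j + 1) (j + 1))
      ((m + 1) * ((m + j + 1).choose j : ℝ) * (1 - u) ^ j * u ^ m) u := by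
  have hterm (n t : ℕ) : HasDerivAt (fun x : ℝ => (n.choose t : ℝ) * (1 - x) ^ t * x ^ (n - t))
      ((n.choose t : ℝ) * (t * (1 - u) ^ (t - 1) * -1) * u ^ (n - t) +
        (n.choose t : ℝ) * (1 - u) ^ t * ((n - t : ℕ) * u ^ (n - t - 1))) u :=
    ((((hasDerivAt_id u).const_sub 1).fun_pow t).const_mul (n.choose t : ℝ)).fun_mul
      (hasDerivAt_pow (n - t) u)
  induction j generalizing m with
  | zero =>
    have h := hterm (m + 1) 0
    have hsum : orderStatisticCDF (m + 1) 1 = fun x : ℝ =>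
        ((m + 1).choose 0 : ℝ) * (1 - x) ^ 0 * x ^ (m + 1 - 0) :=
      funext fun x => Finset.sum_range_one _
    rw [zero_add, add_zero, hsum]
    simpa using h
  | succ j ih =>
    have hn : m + (j + 1) + 1 = m + 1 + j + 1 := by lia
    have hchoose := Nat.choose_succ_right_eq (m + 1 + j + 1) j
    rw [show m + 1 + j + 1 - j = m + 2 by lia] at hchoose
    have hchoose' : ((m + 1 + j + 1).choose (j + 1) : ℝ) * (j + 1) =
        (m + 1 + j + 1).choose j * (m + 2) := mod_cast hchoose
    have h := (ih (m + 1)).add (hterm (m + 1 + j + 1) (j + 1))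
    rw [show m + 1 + j + 1 - (j + 1) = m + 1 by lia] at h
    have hsum : orderStatisticCDF (m + (j + 1) + 1) (j + 1 + 1) =
        orderStatisticCDF (m + 1 + j + 1) (j + 1) + fun x : ℝ =>
          ((m + 1 + j + 1).choose (j + 1) : ℝ) * (1 - x) ^ (j + 1) * x ^ (m + 1) := by
      funext x
      rw [hn, Pi.add_apply, orderStatisticCDF, Finset.sum_range_succ,
        show m + 1 + j + 1 - (j + 1) = m + 1 by lia]
      rfl
    rw [hsum, hn]
    refine h.congr_deriv ?_
    push_cast [Nat.add_sub_cancel]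
    linear_combination -(1 - u) ^ j * u ^ (m + 1) * hchoose'

theorem strictMonoOn_orderStatisticCDF {n k : ℕ} (hk : 1 ≤ k) (hkn : k ≤ n) :
    StrictMonoOn (orderStatisticCDF n k) (Set.Icc 0 1) := by
  obtain ⟨j, rfl⟩ := Nat.exists_eq_add_of_le' hk
  obtain ⟨m, rfl⟩ := Nat.exists_eq_add_of_le' hkn
  refine strictMonoOn_of_deriv_pos (convex_Icc 0 1)
    (continuous_orderStatisticCDF _ _).continuousOn fun u hu => ?_
  rw [interior_Icc] at hu
  have hu0 : 0 < u := hu.1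
  have hu1 : 0 < 1 - u := sub_pos.mpr hu.2
  have hchoose : 0 < (m + j + 1).choose j := Nat.choose_pos (by lia)
  rw [← add_assoc, (hasDerivAt_orderStatisticCDF m j u).deriv]
  positivity

/-- A continuous function which is strictly increasing on the unit interval and fixes its
endpoints restricts to an order automorphism of the unit interval. -/
theorem exists_orderIso_Icc_of_strictMonoOn {f : ℝ → ℝ} (hf : StrictMonoOn f (Set.Icc 0 1))
    (hc : ContinuousOn f (Set.Icc 0 1)) (h0 : f 0 = 0) (h1 : f 1 = 1) :
    ∃ e : Set.Icc (0 : ℝ) 1 ≃o Set.Icc (0 : ℝ) 1, ∀ u, (e u : ℝ) = f u := by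
  have hmaps (u : Set.Icc (0 : ℝ) 1) : f u ∈ Set.Icc (0 : ℝ) 1 := by
    constructor
    · exact h0.symm.trans_le (hf.monotoneOn (by simp) u.2 u.2.1)
    · exact (hf.monotoneOn u.2 (by simp) u.2.2).trans_eq h1
  have hmono : StrictMono fun u : Set.Icc (0 : ℝ) 1 => (⟨f u, hmaps u⟩ : Set.Icc (0 : ℝ) 1) :=
    fun u v huv => hf u.2 v.2 huv
  have hsurj : Function.Surjective
      fun u : Set.Icc (0 : ℝ) 1 => (⟨f u, hmaps u⟩ : Set.Icc (0 : ℝ) 1) := by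
    rintro ⟨y, hy⟩
    obtain ⟨x, hx, hxy⟩ := intermediate_value_Icc zero_le_one hc (by rwa [h0, h1])
    exact ⟨⟨x, hx⟩, Subtype.ext hxy⟩
  exact ⟨hmono.orderIsoOfSurjective _ hsurj, fun _ => rfl⟩

/-- The paper's Claim 2.1: for every CDF `G` there is a unique function `F : ℝ → [0,1]` with
`Σ_{t=0}^{k−1} C(n,t)·(1−F(v))^t·F(v)^{n−t} = G(v)` for all `v` (i.e. the `k`-th order
statistic of `n` i.i.d. draws from `F` has CDF `G`); moreover this `F` is itself a CDF
(nondecreasing, right-continuous, with limits `0` at `−∞` and `1` at `+∞`). -/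
theorem exists_unique_iid_consistent_cdf
    (n k : ℕ) (hn : 1 ≤ n) (hk1 : 1 ≤ k) (hkn : k ≤ n)
    (G : ℝ → ℝ) (hGrange : ∀ v, G v ∈ Set.Icc (0 : ℝ) 1) (hGmono : Monotone G)
    (hGright : ∀ v, ContinuousWithinAt G (Set.Ici v) v)
    (hGbot : Tendsto G atBot (nhds 0)) (hGtop : Tendsto G atTop (nhds 1)) :
    ∃ F : ℝ → ℝ,
      (∀ v, F v ∈ Set.Icc (0 : ℝ) 1) ∧
      (∀ v, ∑ t ∈ Finset.range k, (n.choose t : ℝ) * (1 - F v) ^ t * (F v) ^ (n - t) = G v) ∧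
      Monotone F ∧
      (∀ v, ContinuousWithinAt F (Set.Ici v) v) ∧
      Tendsto F atBot (nhds 0) ∧ Tendsto F atTop (nhds 1) ∧
      (∀ F' : ℝ → ℝ, (∀ v, F' v ∈ Set.Icc (0 : ℝ) 1) →
        (∀ v, ∑ t ∈ Finset.range k, (n.choose t : ℝ) * (1 - F' v) ^ t * (F' v) ^ (n - t) = G v) →
        F' = F) := by
  obtain ⟨e, he⟩ := exists_orderIso_Icc_of_strictMonoOn (strictMonoOn_orderStatisticCDF hk1 hkn)
    (continuous_orderStatisticCDF n k).continuousOn (orderStatisticCDF_zero hkn)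
    (orderStatisticCDF_one hk1)
  let g : ℝ → Set.Icc (0 : ℝ) 1 := fun v => ⟨G v, hGrange v⟩
  have hlim {l : Filter ℝ} {y : Set.Icc (0 : ℝ) 1} (h : Tendsto G l (nhds y)) :
      Tendsto (fun v => (e.symm (g v) : ℝ)) l (nhds (e.symm y)) :=
    ((continuous_subtype_val.comp e.symm.continuous).tendsto y).comp (tendsto_subtype_rng.mpr h)
  refine ⟨fun v => e.symm (g v), fun v => (e.symm (g v)).2, fun v => ?_,
    fun v w hvw => e.symm.monotone (hGmono hvw), fun v => hlim (y := g v) (hGright v),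
    ?_, ?_, fun F' hF' hsol => ?_⟩
  · exact (he _).symm.trans (congrArg Subtype.val (e.apply_symm_apply (g v)))
  · simpa using hlim (y := ⊥) hGbot
  · simpa using hlim (y := ⊤) hGtop
  · funext v
    have hv : e ⟨F' v, hF' v⟩ = g v := Subtype.ext ((he _).trans (hsol v))
    change F' v = e.symm (g v)
    rw [← hv, e.symm_apply_apply]
end

section
/- Let n ≥ 1 and x ∈ [0,1]ⁿ with ∏_{j=1}^n x_j > 0. Then (∏_{j=1}^n x_j) · (1 − ln ∏_{j=1}^n x_j) ≤ Σ_{i=1}^n ∏_{j≠i} x_j − (n−1) · ∏_{j=1}^n x_j. -/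
/-- Combined inequality underlying the paper's Proposition 5.4: writing `z = ∏ⱼ xⱼ` for the
first-order-statistic probability and
`Σᵢ ∏_{j≠i} xⱼ − (n−1)·∏ⱼ xⱼ` for the second-order-statistic probability, one has
`z·(1 − ln z) ≤ Σᵢ ∏_{j≠i} xⱼ − (n−1)·∏ⱼ xⱼ`. -/
theorem prod_one_sub_log_le_secondOrderStat
    (n : ℕ) (hn : 1 ≤ n) (x : Fin n → ℝ) (hx : ∀ j, x j ∈ Set.Icc (0 : ℝ) 1)
    (hpos : 0 < ∏ j, x j) :
    (∏ j, x j) * (1 - Real.log (∏ j, x j)) ≤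
      ∑ i, ∏ j ∈ ({i}ᶜ : Finset (Fin n)), x j - ((n : ℝ) - 1) * ∏ j, x j := by
  have hne : ∀ j, x j ≠ 0 := fun j hj =>
    hpos.ne' (Finset.prod_eq_zero (Finset.mem_univ j) hj)
  have hxpos : ∀ j, 0 < x j := fun j => lt_of_le_of_ne (hx j).1 (hne j).symm
  have hcompl : ∀ i, ∏ j ∈ ({i}ᶜ : Finset (Fin n)), x j = (∏ j, x j) * (x i)⁻¹ := fun i => by
    rw [← Finset.prod_compl_mul_prod {i} x, Finset.prod_singleton, mul_inv_cancel_right₀ (hne i)]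
  have hlog : ∑ j, (1 - (x j)⁻¹) ≤ Real.log (∏ j, x j) := by
    rw [Real.log_prod fun j _ => hne j]
    exact Finset.sum_le_sum fun j _ => Real.one_sub_inv_le_log_of_pos (hxpos j)
  rw [Finset.sum_sub_distrib, Finset.sum_const, Finset.card_univ, Fintype.card_fin,
    nsmul_eq_mul, mul_one] at hlog
  simp only [hcompl, ← Finset.mul_sum]
  linarith [mul_le_mul_of_nonneg_left hlog hpos.le]
end
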